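/- Let n ≥ 2, 0 < p, q ≤ ∞, s ≥ 0 and ε > 0. There exists a constant C > 0 such that for every Schwartz function f ∈ 𝒮(ℝⁿ), ‖Tr f‖_{M^s_{p,q}(ℝ^{n−1})} ≤ C ‖f‖_{M^{s + 1/min(p,q,1) − 1/q + ε}_{p,q}(ℝⁿ)}, where 1/q is interpreted as 0 when q = ∞. -/

import Mathlib

open MeasureTheory FourierTransform
open scoped ENNReal NNReal

noncomputable section

/-- `η` is an admissible bump function: smooth, valued in `[0,1]`, equal to `1` on `|t| ≤ 1`
and vanishing for `|t| ≥ 2`. -/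
def IsBump (η : ℝ → ℝ) : Prop :=
  ContDiff ℝ (⊤ : ℕ∞) η ∧ (∀ t, η t ∈ Set.Icc (0:ℝ) 1) ∧ (∀ t, |t| ≤ 1 → η t = 1) ∧
    (∀ t, 2 ≤ |t| → η t = 0)

/-- Japanese bracket `⟨k⟩ = (1+|k|²)^{1/2}` of an integer vector. -/
def jbr {d : ℕ} (k : Fin d → ℤ) : ℝ := (1 + ∑ i, ((k i : ℝ))^2) ^ ((1:ℝ)/2)

/-- `ψ_k`, the normalized window at frequency `k ∈ ℤ^d`. -/
def unifWindow (η : ℝ → ℝ) {d : ℕ} (k : Fin d → ℤ) (ξ : EuclideanSpace ℝ (Fin d)) : ℝ :=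
  (∏ i, η (2 * (ξ i - k i))) / ∑' l : Fin d → ℤ, ∏ i, η (2 * (ξ i - l i))

/-- The frequency-uniform decomposition operator `□_k f = 𝓕⁻¹(ψ_k 𝓕 f)`. -/
def unifBox (η : ℝ → ℝ) {d : ℕ} (k : Fin d → ℤ) (f : EuclideanSpace ℝ (Fin d) → ℂ) :
    EuclideanSpace ℝ (Fin d) → ℂ :=
  𝓕⁻ (fun ξ => (unifWindow η k ξ : ℂ) * 𝓕 f ξ)

/-- The `ℓ^q` combination of a family of extended nonnegative reals, with the supremum
modification for `q = ∞`. -/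
def lqSum {ι : Type*} (q : ℝ≥0∞) (a : ι → ℝ≥0∞) : ℝ≥0∞ :=
  if q = ∞ then ⨆ i, a i else (∑' i, a i ^ q.toReal) ^ (1 / q.toReal)

/-- The modulation space quasi-norm `‖f‖_{M^s_{p,q}(ℝ^d)}`. -/
def modNorm (η : ℝ → ℝ) {d : ℕ} (s : ℝ) (p q : ℝ≥0∞) (f : EuclideanSpace ℝ (Fin d) → ℂ) :
    ℝ≥0∞ :=
  lqSum q (fun k : Fin d → ℤ =>
    ENNReal.ofReal (jbr k ^ s) * eLpNorm (unifBox η k f) p volume)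

/-- The anisotropic modulation space quasi-norm `‖f‖_{M^s_{p,q,r}(ℝ^{m+1})}`. -/
def modNormAniso (η : ℝ → ℝ) {m : ℕ} (s : ℝ) (p q r : ℝ≥0∞)
    (f : EuclideanSpace ℝ (Fin (m+1)) → ℂ) : ℝ≥0∞ :=
  lqSum r (fun kn : ℤ => lqSum q (fun kb : Fin m → ℤ =>
    ENNReal.ofReal (jbr kb ^ s) *
      eLpNorm (unifBox η (Fin.snoc kb kn) f) p volume))

/-- The trace `(Tr f)(x̄) = f(x̄, 0)` on the hyperplane `x_n = 0`. -/
def traceFn {m : ℕ} (f : EuclideanSpace ℝ (Fin (m+1)) → ℂ)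
    (x : EuclideanSpace ℝ (Fin m)) : ℂ :=
  f ((WithLp.equiv 2 (Fin (m+1) → ℝ)).symm
      (Fin.snoc ((WithLp.equiv 2 (Fin m → ℝ)) x) 0))



theorem reproduce_bound {E : Type*} [AddGroup E] [MeasurableSpace E] (μ : Measure E)
    (w U : E → ℝ≥0∞) (C0 M : ℝ≥0∞) (hM : M ≠ ∞)
    (hw1 : ∀ x, w x ≤ 1) (hwsub : ∀ x y z, w (y - x) * w (z - y) ≤ w (z - x))
    (hwt : ∀ x, w x ≠ ∞)
    (hU : ∀ y, U y ≤ M) (hrep : ∀ y, U y ≤ C0 * ∫⁻ z, w (z - y) * U z ∂μ)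
    (r : ℝ) (hr : 0 < r) (hr1 : r ≤ 1) (x : E) (G : ℝ≥0∞)
    (hG : G ≤ C0 * ∫⁻ z, w (z - x) * U z ∂μ) :
    G ^ r ≤ C0 * ∫⁻ z, (w (z - x) * U z) ^ r ∂μ := by
  set J := ∫⁻ z, (w (z - x) * U z) ^ r ∂μ with hJ
  set A := ⨆ y, w (y - x) * U y with hA
  have hAM : A ≤ M := iSup_le fun y => by
    calc w (y - x) * U y ≤ 1 * M := mul_le_mul' (hw1 _) (hU y)
      _ = M := one_mul _
  have hAt : A ≠ ∞ := ne_top_of_le_ne_top hM hAM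
  have h1r : 0 ≤ 1 - r := by linarith
  have hAr : A ^ (1 - r) ≠ ∞ := ENNReal.rpow_ne_top_of_nonneg h1r hAt
  have split : ∀ a : ℝ≥0∞, a ^ (1 - r) * a ^ r = a := fun a => by
    rw [← ENNReal.rpow_add_of_nonneg _ _ h1r hr.le]; simp
  have key : ∫⁻ z, w (z - x) * U z ∂μ ≤ A ^ (1 - r) * J := by
    rw [hJ, ← lintegral_const_mul' _ _ hAr]
    refine lintegral_mono fun z => ?_
    calc w (z - x) * U z = (w (z - x) * U z) ^ (1 - r) * (w (z - x) * U z) ^ r := (split _).symm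
      _ ≤ _ := by
        gcongr
        exact le_iSup (fun y => w (y - x) * U y) z
  have hAle : A ≤ C0 * (A ^ (1 - r) * J) := by
    refine iSup_le fun y => ?_
    calc w (y - x) * U y ≤ w (y - x) * (C0 * ∫⁻ z, w (z - y) * U z ∂μ) := by gcongr; exact hrep y
      _ = C0 * ∫⁻ z, w (y - x) * (w (z - y) * U z) ∂μ := by
        rw [lintegral_const_mul' _ _ (hwt _)]; ring
      _ ≤ C0 * ∫⁻ z, w (z - x) * U z ∂μ := by
        refine mul_le_mul' le_rfl (lintegral_mono fun z => ?_)
        rw [← mul_assoc]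
        exact mul_le_mul' (hwsub x y z) le_rfl
      _ ≤ _ := by gcongr
  have hArJ : A ^ r ≤ C0 * J := by
    by_cases h0 : A = 0
    · rw [h0, ENNReal.zero_rpow_of_pos hr]; exact zero_le
    · have h0' : A ^ (1 - r) ≠ 0 := by
        simp [ENNReal.rpow_eq_zero_iff, h0, hAt]
      rw [← ENNReal.mul_le_mul_iff_right h0' hAr, split]
      calc A ≤ _ := hAle
        _ = _ := by ring
  calc G ^ r ≤ (C0 * (A ^ (1 - r) * J)) ^ r := by
        gcongr
        exact hG.trans (by gcongr)
    _ = (A ^ r) ^ (1 - r) * (C0 * J) ^ r := by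
        rw [show C0 * (A ^ (1 - r) * J) = A ^ (1 - r) * (C0 * J) by ring,
          ENNReal.mul_rpow_of_nonneg _ _ hr.le, ← ENNReal.rpow_mul, ← ENNReal.rpow_mul, mul_comm r]
    _ ≤ (C0 * J) ^ (1 - r) * (C0 * J) ^ r := by gcongr
    _ = _ := split _

theorem trace_Lp_bound {E F : Type*} [AddGroup E] [MeasurableSpace E] [MeasurableSub₂ E]
    [MeasurableSpace F] (μ : Measure E) [SFinite μ] (ν : Measure F) [SFinite ν]
    (ι : F → E) (hι : Measurable ι)
    (w : E → ℝ≥0∞) (hwm : Measurable w) (hw1 : ∀ x, w x ≤ 1)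
    (hwsub : ∀ x y z, w (y - x) * w (z - y) ≤ w (z - x))
    (p : ℝ≥0∞) (hp : 0 < p) (D1 D2 : ℝ≥0∞) (hD1 : D1 ≠ ∞) (hD2 : D2 ≠ ∞)
    (hI1 : ∀ x, ∫⁻ z, w (z - x) ∂μ ≤ D1)
    (hI2 : ∀ z, ∫⁻ x, w (z - ι x) ^ (min p 1).toReal ∂ν ≤ D2)
    (C0 : ℝ≥0∞) (hC0 : C0 ≠ ∞) :
    ∃ D : ℝ≥0∞, D ≠ ∞ ∧ ∀ (U : E → ℝ≥0∞) (G : F → ℝ≥0∞) (M : ℝ≥0∞), M ≠ ∞ → Measurable U →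
      (∀ y, U y ≤ M) → (∀ y, U y ≤ C0 * ∫⁻ z, w (z - y) * U z ∂μ) →
      (∀ x, G x ≤ C0 * ∫⁻ z, w (z - ι x) * U z ∂μ) →
      eLpNorm G p ν ≤ D * eLpNorm U p μ := by
  have hwt : ∀ x, w x ≠ ∞ := fun x => ne_top_of_le_ne_top ENNReal.one_ne_top (hw1 x)
  by_cases hpt : p = ∞
  · subst hpt
    refine ⟨C0 * D1, ENNReal.mul_ne_top hC0 hD1, fun U G M hM hUm hU hrep hG => ?_⟩
    simp only [eLpNorm_exponent_top]
    refine eLpNormEssSup_le_of_ae_enorm_bound (Filter.Eventually.of_forall fun x => ?_)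
    simp only [enorm_eq_self]
    refine (hG x).trans ?_
    rw [mul_assoc]
    gcongr
    calc ∫⁻ z, w (z - ι x) * U z ∂μ ≤ ∫⁻ z, w (z - ι x) * eLpNormEssSup U μ ∂μ := by
          refine lintegral_mono_ae ?_
          filter_upwards [enorm_ae_le_eLpNormEssSup U μ] with z hz
          gcongr
          simpa using hz
      _ = (∫⁻ z, w (z - ι x) ∂μ) * eLpNormEssSup U μ := by
          rw [lintegral_mul_const]
          fun_prop
      _ ≤ _ := by gcongr; exact hI1 _
  have hp0 : p ≠ 0 := hp.ne'
  have hpr : 0 < p.toReal := ENNReal.toReal_pos hp0 hpt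
  suffices h : ∃ D : ℝ≥0∞, D ≠ ∞ ∧ ∀ (U : E → ℝ≥0∞) (G : F → ℝ≥0∞) (M : ℝ≥0∞), M ≠ ∞ →
      Measurable U →
      (∀ y, U y ≤ M) → (∀ y, U y ≤ C0 * ∫⁻ z, w (z - y) * U z ∂μ) →
      (∀ x, G x ≤ C0 * ∫⁻ z, w (z - ι x) * U z ∂μ) →
      ∃ r : ℝ, (∀ z, ∫⁻ x, w (z - ι x) ^ r ∂ν ≤ D2) ∧
      ∀ x, G x ^ p.toReal ≤ D * ∫⁻ z, w (z - ι x) ^ r * U z ^ p.toReal ∂μ by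
    obtain ⟨D, hD, h⟩ := h
    refine ⟨(D * D2) ^ (1 / p.toReal), ENNReal.rpow_ne_top_of_nonneg (by positivity)
      (ENNReal.mul_ne_top hD hD2), fun U G M hM hUm hU hrep hG => ?_⟩
    obtain ⟨r, hr, h⟩ := h U G M hM hUm hU hrep hG
    rw [eLpNorm_eq_lintegral_rpow_enorm_toReal hp0 hpt,
      eLpNorm_eq_lintegral_rpow_enorm_toReal hp0 hpt, ← ENNReal.mul_rpow_of_nonneg _ _ (by positivity)]
    gcongr
    simp only [enorm_eq_self]
    calc ∫⁻ x, G x ^ p.toReal ∂ν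
        ≤ ∫⁻ x, D * ∫⁻ z, w (z - ι x) ^ r * U z ^ p.toReal ∂μ ∂ν := lintegral_mono h
      _ = D * ∫⁻ x, ∫⁻ z, w (z - ι x) ^ r * U z ^ p.toReal ∂μ ∂ν := lintegral_const_mul' _ _ hD
      _ = D * ∫⁻ z, ∫⁻ x, w (z - ι x) ^ r * U z ^ p.toReal ∂ν ∂μ := by
          rw [lintegral_lintegral_swap]
          apply Measurable.aemeasurable
          unfold Function.uncurry
          fun_prop
      _ = D * ∫⁻ z, (∫⁻ x, w (z - ι x) ^ r ∂ν) * U z ^ p.toReal ∂μ := by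
          congr 1
          refine lintegral_congr fun z => ?_
          rw [lintegral_mul_const]
          fun_prop
      _ ≤ D * ∫⁻ z, D2 * U z ^ p.toReal ∂μ := by
          gcongr with z
          exact hr z
      _ = _ := by rw [lintegral_const_mul' _ _ hD2, mul_assoc]
  rcases le_total p 1 with hp1 | hp1
  · refine ⟨C0, hC0, fun U G M hM hUm hU hrep hG => ⟨p.toReal, ?_, fun x => ?_⟩⟩
    · simpa [min_eq_left hp1] using hI2
    · have := reproduce_bound μ w U C0 M hM hw1 hwsub hwt hU hrep p.toReal hpr
        (by simpa using ENNReal.toReal_mono ENNReal.one_ne_top hp1) (ι x) (G x) (hG x)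
      simpa [ENNReal.mul_rpow_of_nonneg _ _ hpr.le] using this
  · have hp1' : 1 ≤ p.toReal := by simpa using ENNReal.toReal_mono hpt hp1
    refine ⟨C0 ^ p.toReal * D1 ^ (p.toReal - 1), ENNReal.mul_ne_top
      (ENNReal.rpow_ne_top_of_nonneg hpr.le hC0)
      (ENNReal.rpow_ne_top_of_nonneg (by linarith) hD1),
      fun U G M hM hUm hU hrep hG => ⟨1, ?_, fun x => ?_⟩⟩
    · simpa [min_eq_right hp1] using hI2
    · simp only [ENNReal.rpow_one]
      refine (ENNReal.rpow_le_rpow (hG x) hpr.le).trans ?_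
      rw [ENNReal.mul_rpow_of_nonneg _ _ hpr.le, mul_assoc]
      gcongr
      have hwx : Measurable fun z => w (z - ι x) := by fun_prop
      have e1 := lintegral_withDensity_eq_lintegral_mul μ hwx hUm
      have e2 := lintegral_withDensity_eq_lintegral_mul μ hwx (hUm.pow_const p.toReal)
      simp only [Pi.mul_apply] at e1 e2
      rw [← e1, ← e2]
      have hJ := eLpNorm'_le_eLpNorm'_mul_rpow_measure_univ (μ := μ.withDensity fun z => w (z - ι x))
        (f := U) zero_lt_one hp1' hUm.aestronglyMeasurable
      simp only [eLpNorm', enorm_eq_self, ENNReal.rpow_one, div_one] at hJ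
      refine (ENNReal.rpow_le_rpow hJ hpr.le).trans ?_
      rw [ENNReal.mul_rpow_of_nonneg _ _ hpr.le, ← ENNReal.rpow_mul, ← ENNReal.rpow_mul,
        one_div_mul_cancel hpr.ne', ENNReal.rpow_one, mul_comm]
      gcongr
      rw [withDensity_apply _ MeasurableSet.univ, Measure.restrict_univ]
      rw [show (1 - 1 / p.toReal) * p.toReal = p.toReal - 1 by field_simp]
      exact ENNReal.rpow_le_rpow (hI1 _) (by linarith)


theorem rpow_tsum_le {ι : Type*} (a : ι → ℝ≥0∞) (r : ℝ) (hr : 0 < r) (hr1 : r ≤ 1) :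
    (∑' i, a i) ^ r ≤ ∑' i, a i ^ r := by
  have hfin : ∀ s : Finset ι, (∑ i ∈ s, a i) ^ r ≤ ∑ i ∈ s, a i ^ r := by
    classical
    intro s
    induction s using Finset.induction_on with
    | empty => simp [hr]
    | insert i s hi ih =>
      rw [Finset.sum_insert hi, Finset.sum_insert hi]
      exact (ENNReal.rpow_add_le_add_rpow _ _ hr.le hr1).trans (by gcongr)
  rw [← ENNReal.rpow_le_rpow_iff (z := 1 / r) (by positivity), ← ENNReal.rpow_mul,
    mul_one_div_cancel hr.ne', ENNReal.rpow_one, ENNReal.tsum_eq_iSup_sum]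
  refine iSup_le fun s => ?_
  rw [← ENNReal.rpow_le_rpow_iff (z := r) hr, ← ENNReal.rpow_mul,
    one_div_mul_cancel hr.ne', ENNReal.rpow_one]
  exact (hfin s).trans (ENNReal.sum_le_tsum s)

theorem minkowski_tsum {X ι : Type*} [MeasurableSpace X] [Countable ι] (ν : Measure X)
    (H : ι → X → ℝ≥0∞) (hH : ∀ i, Measurable (H i)) (P : ℝ) (hP : 1 ≤ P) :
    (∫⁻ x, (∑' i, H i x) ^ P ∂ν) ^ (1 / P) ≤ ∑' i, (∫⁻ x, H i x ^ P ∂ν) ^ (1 / P) := by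
  have hP0 : 0 < P := by linarith
  have hfin : ∀ s : Finset ι, (∫⁻ x, (∑ i ∈ s, H i x) ^ P ∂ν) ^ (1 / P) ≤
      ∑ i ∈ s, (∫⁻ x, H i x ^ P ∂ν) ^ (1 / P) := by
    classical
    intro s
    induction s using Finset.induction_on with
    | empty => simp [hP0]
    | insert i s hi ih =>
      simp only [Finset.sum_insert hi]
      refine (ENNReal.lintegral_Lp_add_le (hH i).aemeasurable
        (Finset.measurable_fun_sum s fun i _ => hH i).aemeasurable hP).trans (by gcongr)
  have hpt : ∀ x, (∑' i, H i x) ^ P = ⨆ s : Finset ι, (∑ i ∈ s, H i x) ^ P := fun x => by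
    rw [ENNReal.tsum_eq_iSup_sum]
    exact (ENNReal.orderIsoRpow P hP0).map_iSup _
  simp_rw [hpt]
  rw [lintegral_iSup_directed]
  · rw [show (⨆ s : Finset ι, ∫⁻ x, (∑ i ∈ s, H i x) ^ P ∂ν) ^ (1 / P) =
      ⨆ s : Finset ι, (∫⁻ x, (∑ i ∈ s, H i x) ^ P ∂ν) ^ (1 / P) from
      (ENNReal.orderIsoRpow (1 / P) (by positivity)).map_iSup _]
    exact iSup_le fun s => (hfin s).trans (ENNReal.sum_le_tsum s)
  · intro s
    exact ((Finset.measurable_fun_sum s fun i _ => hH i).pow_const P).aemeasurable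
  · refine Monotone.directed_le fun s t hst x => ?_
    exact ENNReal.rpow_le_rpow (Finset.sum_le_sum_of_subset hst) hP0.le

theorem eLpNorm_tsum_rpow_le {X ι : Type*} [MeasurableSpace X] [Countable ι] (ν : Measure X)
    (H : ι → X → ℝ≥0∞) (hH : ∀ i, Measurable (H i)) (p : ℝ≥0∞) (hp : 0 < p) (r : ℝ) (hr : 0 < r)
    (hr1 : r ≤ 1) (hrp : ENNReal.ofReal r ≤ p) :
    eLpNorm (fun x => ∑' i, H i x) p ν ^ r ≤ ∑' i, eLpNorm (H i) p ν ^ r := by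
  by_cases hpt : p = ∞
  · subst hpt
    refine le_trans ?_ (rpow_tsum_le _ r hr hr1 |>.trans le_rfl)
    gcongr
    simp only [eLpNorm_exponent_top]
    refine eLpNormEssSup_le_of_ae_enorm_bound ?_
    have : ∀ᵐ x ∂ν, ∀ i, ‖H i x‖ₑ ≤ eLpNormEssSup (H i) ν :=
      ae_all_iff.2 fun i => enorm_ae_le_eLpNormEssSup (H i) ν
    filter_upwards [this] with x hx
    simp only [enorm_eq_self] at hx ⊢
    exact ENNReal.tsum_le_tsum hx
  have hpr : 0 < p.toReal := ENNReal.toReal_pos hp.ne' hpt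
  have hP : 1 ≤ p.toReal / r := by
    rw [one_le_div hr]
    rw [← ENNReal.ofReal_le_iff_le_toReal hpt]
    exact hrp
  simp only [eLpNorm_eq_lintegral_rpow_enorm_toReal hp.ne' hpt, enorm_eq_self, ← ENNReal.rpow_mul]
  have key := minkowski_tsum ν (fun i x => H i x ^ r) (fun i => (hH i).pow_const r) _ hP
  simp only [← ENNReal.rpow_mul, mul_div_cancel₀ _ hr.ne'] at key
  rw [show 1 / p.toReal * r = 1 / (p.toReal / r) by field_simp]
  refine le_trans ?_ key
  gcongr with x
  rw [show (∑' i, H i x) ^ p.toReal = ((∑' i, H i x) ^ r) ^ (p.toReal / r) by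
    rw [← ENNReal.rpow_mul, mul_div_cancel₀ _ hr.ne']]
  gcongr
  exact rpow_tsum_le _ r hr hr1


def wt (b : ℝ) (t : ℤ) : ℝ≥0∞ := ENNReal.ofReal ((1 + (t : ℝ) ^ 2) ^ (-b / 2))

theorem wt_le_one (b : ℝ) (hb : 0 ≤ b) (t : ℤ) : wt b t ≤ 1 := by
  unfold wt
  rw [ENNReal.ofReal_le_one]
  exact Real.rpow_le_one_of_one_le_of_nonpos (by nlinarith [sq_nonneg (t:ℝ)]) (by linarith)

theorem wt_rpow (b c : ℝ) (hc : 0 ≤ c) (t : ℤ) : wt b t ^ c = wt (b * c) t := by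
  unfold wt
  rw [ENNReal.ofReal_rpow_of_nonneg (by positivity) hc, ← Real.rpow_mul (by positivity)]
  congr 2
  ring

theorem tsum_wt (b : ℝ) (hb : 1 < b) : ∑' t, wt b t ≠ ∞ := by
  have hs : Summable fun t : ℤ => (1 + (t : ℝ) ^ 2) ^ (-b / 2) := by
    refine Summable.of_nonneg_of_le (fun t => by positivity) (fun t => ?_)
      ((Real.summable_abs_int_rpow hb).add (hasSum_ite_eq (0:ℤ) (1:ℝ)).summable)
    by_cases ht : t = 0
    · subst ht
      simp only [Int.cast_zero, abs_zero, if_true]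
      have : (0:ℝ) ≤ 0 ^ (-b) := by positivity
      norm_num
      exact this
    · have ht' : 0 < |(t:ℝ)| := by positivity
      simp only [ht, if_false, add_zero]
      rw [show |(t:ℝ)| ^ (-b) = (|(t:ℝ)| ^ (2:ℝ)) ^ (-b/2) by
        rw [← Real.rpow_mul ht'.le]; congr 1; ring]
      refine Real.rpow_le_rpow_of_nonpos (by positivity) ?_ (by linarith)
      rw [Real.rpow_two, sq_abs]; linarith
  unfold wt
  rw [← ENNReal.ofReal_tsum_of_nonneg (fun t => by positivity) hs]
  exact ENNReal.ofReal_ne_top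

theorem holder_tsum (P b : ℝ) (hP : 1 ≤ P) (hb0 : 0 ≤ b) (hb : 1 - 1 / P < b) :
    ∃ K : ℝ≥0∞, K ≠ ∞ ∧ ∀ c : ℤ → ℝ≥0∞, (∑' t, wt b t * c t) ^ P ≤ K * ∑' t, c t ^ P := by
  rcases hP.eq_or_lt with rfl | hP1
  · refine ⟨1, ENNReal.one_ne_top, fun c => ?_⟩
    simp only [ENNReal.rpow_one, one_mul]
    exact ENNReal.tsum_le_tsum fun t => (mul_le_mul' (wt_le_one b hb0 t) le_rfl).trans (one_mul _).le
  · have hP0 : 0 < P := by linarith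
    have hc : P.HolderConjugate (P / (P - 1)) := Real.HolderConjugate.conjExponent hP1
    set Q := P / (P - 1) with hQ
    have hQ0 : 0 < Q := hc.symm.pos
    have hbQ : 1 < b * Q := by
      rw [hQ, ← mul_div_assoc, lt_div_iff₀ (by linarith)]
      have : (1 - 1 / P) * P < b * P := by gcongr
      have h2 : (1 - 1 / P) * P = P - 1 := by field_simp
      linarith
    refine ⟨(∑' t, wt (b * Q) t) ^ (P / Q), ENNReal.rpow_ne_top_of_nonneg (by positivity)
      (tsum_wt _ hbQ), fun c => ?_⟩
    have h := ENNReal.lintegral_mul_le_Lp_mul_Lq (Measure.count : Measure ℤ) hc.symm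
      (f := wt b) (g := c) (measurable_of_countable _).aemeasurable
      (measurable_of_countable _).aemeasurable
    simp only [lintegral_count, Pi.mul_apply, wt_rpow b Q hQ0.le] at h
    refine (ENNReal.rpow_le_rpow h hP0.le).trans ?_
    rw [ENNReal.mul_rpow_of_nonneg _ _ hP0.le, ← ENNReal.rpow_mul, ← ENNReal.rpow_mul,
      one_div_mul_cancel hP0.ne', ENNReal.rpow_one, one_div_mul_eq_div]

theorem seq_bound (m : ℕ) (q : ℝ≥0∞) (hq : 0 < q) (r : ℝ) (hr : 0 < r)
    (hrq : ENNReal.ofReal r ≤ q) (b : ℝ) (hb0 : 0 ≤ b)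
    (hb : 1 - r * (if q = ∞ then 0 else 1 / q.toReal) < b) (C0 : ℝ≥0∞) (hC0 : C0 ≠ ∞)
    (J : Finset (Fin m → ℤ)) :
    ∃ D : ℝ≥0∞, D ≠ ∞ ∧ ∀ (A : (Fin m → ℤ) → ℝ≥0∞) (B : (Fin (m+1) → ℤ) → ℝ≥0∞),
      (∀ k, A k ^ r ≤ C0 * ∑ j ∈ J, ∑' t : ℤ, wt b t *
        B (Fin.snoc (α := fun _ => ℤ) (k + j) t) ^ r) → lqSum q A ≤ D * lqSum q B := by
  by_cases hqt : q = ∞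
  · subst hqt
    simp only [if_true, mul_zero, sub_zero] at hb
    refine ⟨(C0 * ∑ j ∈ J, ∑' t : ℤ, wt b t) ^ (1 / r), ?_, fun A B h => ?_⟩
    · refine ENNReal.rpow_ne_top_of_nonneg (by positivity) (ENNReal.mul_ne_top hC0 ?_)
      exact ENNReal.sum_ne_top.2 fun j _ => tsum_wt b hb
    · simp only [lqSum, if_true]
      refine iSup_le fun k => ?_
      rw [← ENNReal.rpow_le_rpow_iff hr, ENNReal.mul_rpow_of_nonneg _ _ hr.le, ← ENNReal.rpow_mul,
        one_div_mul_cancel hr.ne', ENNReal.rpow_one]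
      refine (h k).trans ?_
      rw [mul_assoc, Finset.sum_mul]
      simp_rw [← ENNReal.tsum_mul_right]
      refine mul_le_mul' le_rfl (Finset.sum_le_sum fun j _ => ENNReal.tsum_le_tsum fun t => ?_)
      refine mul_le_mul' le_rfl (ENNReal.rpow_le_rpow ?_ hr.le)
      exact le_iSup B _
  have hqr : 0 < q.toReal := ENNReal.toReal_pos hq.ne' hqt
  have hP : 1 ≤ q.toReal / r := by
    rw [one_le_div hr, ← ENNReal.ofReal_le_iff_le_toReal hqt]
    exact hrq
  set P := q.toReal / r with hPdef
  have hP0 : 0 < P := by linarith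
  simp only [hqt, if_false] at hb
  obtain ⟨K, hK, hKc⟩ := holder_tsum P b hP hb0 (by
    convert hb using 2
    rw [hPdef]; field_simp)
  refine ⟨(C0 ^ P * ((J.card : ℝ≥0∞) ^ (P - 1) * (K * J.card))) ^ (1 / q.toReal), ?_, fun A B h => ?_⟩
  · refine ENNReal.rpow_ne_top_of_nonneg (by positivity) (ENNReal.mul_ne_top
      (ENNReal.rpow_ne_top_of_nonneg hP0.le hC0) (ENNReal.mul_ne_top
        (ENNReal.rpow_ne_top_of_nonneg (by linarith) (ENNReal.natCast_ne_top _))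
        (ENNReal.mul_ne_top hK (ENNReal.natCast_ne_top _))))
  simp only [lqSum, hqt, if_false]
  rw [← ENNReal.mul_rpow_of_nonneg _ _ (by positivity)]
  gcongr
  have hpt : ∀ k, A k ^ q.toReal ≤ C0 ^ P * ((J.card : ℝ≥0∞) ^ (P - 1) * (K * ∑ j ∈ J,
      ∑' t : ℤ, B (Fin.snoc (α := fun _ => ℤ) (k + j) t) ^ q.toReal)) := by
    intro k
    calc A k ^ q.toReal = (A k ^ r) ^ P := by
          rw [← ENNReal.rpow_mul, hPdef, mul_div_cancel₀ _ hr.ne']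
      _ ≤ (C0 * ∑ j ∈ J, ∑' t : ℤ, wt b t *
        B (Fin.snoc (α := fun _ => ℤ) (k + j) t) ^ r) ^ P := by
          exact ENNReal.rpow_le_rpow (h k) hP0.le
      _ ≤ _ := by
          rw [ENNReal.mul_rpow_of_nonneg _ _ hP0.le]
          refine mul_le_mul' le_rfl ?_
          refine (ENNReal.rpow_sum_le_const_mul_sum_rpow _ _ hP).trans ?_
          refine mul_le_mul' le_rfl ?_
          rw [Finset.mul_sum]
          refine Finset.sum_le_sum fun j _ => ?_
          refine (hKc _).trans ?_
          refine mul_le_mul' le_rfl (ENNReal.tsum_le_tsum fun t => ?_)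
          rw [← ENNReal.rpow_mul, hPdef, mul_div_cancel₀ _ hr.ne']
  refine (ENNReal.tsum_le_tsum hpt).trans ?_
  simp_rw [ENNReal.tsum_mul_left]
  simp only [mul_assoc]
  refine mul_le_mul' le_rfl (mul_le_mul' le_rfl (mul_le_mul' le_rfl ?_))
  rw [Summable.tsum_finsetSum (fun _ _ => ENNReal.summable)]
  have : ∀ j ∈ J, ∑' k : Fin m → ℤ, ∑' t : ℤ, B (Fin.snoc (α := fun _ => ℤ) (k + j) t) ^ q.toReal
      = ∑' l, B l ^ q.toReal := by
    intro j _
    refine ((Equiv.addRight j).tsum_eq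
      (fun k => ∑' t : ℤ, B (Fin.snoc (α := fun _ => ℤ) k t) ^ q.toReal)).trans ?_
    rw [ENNReal.tsum_comm, ← ENNReal.tsum_prod,
      ← (Fin.snocEquiv fun _ : Fin (m+1) => ℤ).tsum_eq (fun l => B l ^ q.toReal)]
    rfl
  rw [Finset.sum_congr rfl this]
  simp


section window
variable {η : ℝ → ℝ} {d : ℕ}

/-- Integer vectors as points of Euclidean space. -/
def intVec (k : Fin d → ℤ) : EuclideanSpace ℝ (Fin d) := WithLp.toLp 2 (fun i => (k i : ℝ))

theorem bump_term_eq_zero (hη : IsBump η) (k : Fin d → ℤ) (ξ : EuclideanSpace ℝ (Fin d)) (i : Fin d)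
    (h : 1 ≤ |ξ i - k i|) : ∏ i, η (2 * (ξ i - k i)) = 0 := by
  refine Finset.prod_eq_zero (Finset.mem_univ i) (hη.2.2.2 _ ?_)
  rw [abs_mul, abs_two]; linarith

theorem bump_term_nonneg (hη : IsBump η) (k : Fin d → ℤ) (ξ : EuclideanSpace ℝ (Fin d)) :
    0 ≤ ∏ i, η (2 * (ξ i - k i)) :=
  Finset.prod_nonneg fun _ _ => (hη.2.1 _).1

theorem bump_locallyFinite (hη : IsBump η) : LocallyFinite fun k : Fin d → ℤ =>
    Function.support fun ξ : EuclideanSpace ℝ (Fin d) => ∏ i, η (2 * (ξ i - k i)) := by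
  intro ξ
  refine ⟨Metric.ball ξ 1, Metric.ball_mem_nhds ξ one_pos, ?_⟩
  refine (Set.finite_Icc (fun i => ⌊ξ i⌋ - 3) (fun i => ⌊ξ i⌋ + 3)).subset ?_
  rintro k ⟨x, hx, hxb⟩
  have hb : ∀ i, |x i - ξ i| < 1 := fun i => by
    have h1 := PiLp.norm_apply_le (x - ξ) i
    rw [Metric.mem_ball, dist_eq_norm] at hxb
    simp only [PiLp.sub_apply, Real.norm_eq_abs] at h1
    linarith
  have hk : ∀ i, |x i - k i| < 1 := fun i => by
    by_contra hcon
    exact hx (bump_term_eq_zero hη k x i (not_lt.1 hcon))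
  have hf : ∀ i, |(k i : ℝ) - ⌊ξ i⌋| < 3 := fun i => by
    have h1 := abs_lt.1 (hb i)
    have h2 := abs_lt.1 (hk i)
    have h3 := Int.floor_le (ξ i)
    have h4 := Int.lt_floor_add_one (ξ i)
    rw [abs_lt]; constructor <;> linarith
  constructor <;> intro i <;> have h := abs_lt.1 (hf i) <;> simp only
  · have : ((⌊ξ i⌋ - 3 : ℤ) : ℝ) < (k i : ℝ) := by push_cast; linarith
    exact_mod_cast this.le
  · have : (k i : ℝ) < ((⌊ξ i⌋ + 3 : ℤ) : ℝ) := by push_cast; linarith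
    exact_mod_cast this.le

theorem bump_summable (hη : IsBump η) (ξ : EuclideanSpace ℝ (Fin d)) :
    (Function.support fun k : Fin d → ℤ => ∏ i, η (2 * (ξ i - k i))).Finite :=
  (bump_locallyFinite hη).point_finite ξ

theorem bump_sum_ge (hη : IsBump η) (ξ : EuclideanSpace ℝ (Fin d)) :
    1 ≤ ∑' l : Fin d → ℤ, ∏ i, η (2 * (ξ i - l i)) := by
  have h : ∏ i, η (2 * (ξ i - (fun i => round (ξ i)) i)) = 1 := by
    refine Finset.prod_eq_one fun i _ => hη.2.2.1 _ ?_
    rw [abs_mul, abs_two]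
    have := abs_sub_round (ξ i)
    simp only
    linarith
  rw [← h]
  exact (summable_of_hasFiniteSupport (bump_summable hη ξ)).le_tsum _
    (fun k _ => bump_term_nonneg hη k ξ)

theorem bump_sum_contDiff (hη : IsBump η) : ContDiff ℝ (⊤ : ℕ∞)
    fun ξ : EuclideanSpace ℝ (Fin d) => ∑' l : Fin d → ℤ, ∏ i, η (2 * (ξ i - l i)) := by
  have : (fun ξ : EuclideanSpace ℝ (Fin d) => ∑' l : Fin d → ℤ, ∏ i, η (2 * (ξ i - l i)))
      = fun ξ => ∑ᶠ l : Fin d → ℤ, ∏ i, η (2 * (ξ i - l i)) := by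
    ext ξ
    exact tsum_eq_finsum (by exact bump_summable hη ξ)
  rw [this, ← contMDiff_iff_contDiff]
  refine contMDiff_finsum (fun l => ?_) (bump_locallyFinite hη)
  rw [contMDiff_iff_contDiff]
  refine contDiff_prod fun i _ => hη.1.comp ?_
  fun_prop

theorem unifWindow_contDiff (hη : IsBump η) (k : Fin d → ℤ) :
    ContDiff ℝ (⊤ : ℕ∞) (unifWindow η k) := by
  unfold unifWindow
  refine ContDiff.div (contDiff_prod fun i _ => hη.1.comp (by fun_prop)) (bump_sum_contDiff hη) ?_
  intro ξ
  have := bump_sum_ge hη ξ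
  linarith

theorem unifWindow_nonneg (hη : IsBump η) (k : Fin d → ℤ) (ξ) : 0 ≤ unifWindow η k ξ :=
  div_nonneg (bump_term_nonneg hη k ξ) (zero_le_one.trans (bump_sum_ge hη ξ))

theorem unifWindow_eq_zero (hη : IsBump η) (k : Fin d → ℤ) (ξ : EuclideanSpace ℝ (Fin d)) (i : Fin d)
    (h : 1 ≤ |ξ i - k i|) : unifWindow η k ξ = 0 := by
  unfold unifWindow
  rw [bump_term_eq_zero hη k ξ i h, zero_div]

theorem unifWindow_hasSum (hη : IsBump η) (ξ : EuclideanSpace ℝ (Fin d)) :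
    HasSum (fun k => unifWindow η k ξ) 1 := by
  have hs : Summable fun k : Fin d → ℤ => ∏ i, η (2 * (ξ i - k i)) :=
    summable_of_hasFiniteSupport (bump_summable hη ξ)
  have h := hs.hasSum.div_const
    (∑' l : Fin d → ℤ, ∏ i, η (2 * (ξ i - l i)))
  rwa [div_self (by have := bump_sum_ge hη ξ; linarith)] at h

theorem unifWindow_le_one (hη : IsBump η) (k : Fin d → ℤ) (ξ) : unifWindow η k ξ ≤ 1 :=
  le_hasSum (unifWindow_hasSum hη ξ) k fun j _ => unifWindow_nonneg hη j ξ

theorem unifWindow_translate (k j : Fin d → ℤ) (ξ : EuclideanSpace ℝ (Fin d)) :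
    unifWindow η (k + j) (ξ + intVec k) = unifWindow η j ξ := by
  unfold unifWindow
  congr 1
  · refine Finset.prod_congr rfl fun i _ => ?_
    simp only [intVec, PiLp.add_apply, Pi.add_apply, Int.cast_add]
    congr 2; ring
  · rw [← (Equiv.addLeft k).tsum_eq]
    refine tsum_congr fun l => Finset.prod_congr rfl fun i _ => ?_
    simp only [intVec, PiLp.add_apply, Pi.add_apply, Int.cast_add, Equiv.coe_addLeft]
    congr 2; ring

/-- Larger cutoff, equal to one on the support of the window at zero. -/
def bigWindow (η : ℝ → ℝ) (ξ : EuclideanSpace ℝ (Fin d)) : ℝ := ∏ i, η (ξ i)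

theorem bigWindow_contDiff (hη : IsBump η) :
    ContDiff ℝ (⊤ : ℕ∞) (bigWindow (d := d) η) :=
  contDiff_prod fun i _ => hη.1.comp (by fun_prop)

theorem compact_of_coord (φ : EuclideanSpace ℝ (Fin d) → ℂ) (R : ℝ)
    (h : ∀ ξ i, R ≤ |ξ i| → φ ξ = 0) : HasCompactSupport φ := by
  refine HasCompactSupport.of_support_subset_isCompact
    (K := Metric.closedBall 0 (Real.sqrt (∑ _i : Fin d, R ^ 2))) (isCompact_closedBall _ _) ?_
  intro ξ hξ
  have h' : ∀ i, |ξ i| < R := fun i => by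
    by_contra hc
    exact hξ (h ξ i (not_lt.1 hc))
  rw [mem_closedBall_zero_iff, EuclideanSpace.norm_eq]
  refine Real.sqrt_le_sqrt (Finset.sum_le_sum fun i _ => ?_)
  rw [Real.norm_eq_abs]
  exact pow_le_pow_left₀ (abs_nonneg _) (h' i).le 2

theorem bigWindow_eq_zero (hη : IsBump η) (ξ : EuclideanSpace ℝ (Fin d)) (i : Fin d)
    (h : 2 ≤ |ξ i|) : bigWindow η ξ = 0 :=
  Finset.prod_eq_zero (Finset.mem_univ i) (hη.2.2.2 _ h)

theorem bigWindow_mul (hη : IsBump η) (l : Fin d → ℤ) (ξ : EuclideanSpace ℝ (Fin d)) :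
    bigWindow η (ξ - intVec l) * unifWindow η l ξ = unifWindow η l ξ := by
  by_cases h : ∃ i, 1 ≤ |ξ i - l i|
  · obtain ⟨i, hi⟩ := h
    rw [unifWindow_eq_zero hη l ξ i hi, mul_zero]
  · push Not at h
    have : bigWindow η (ξ - intVec l) = 1 := by
      refine Finset.prod_eq_one fun i _ => hη.2.2.1 _ ?_
      simpa [intVec] using (h i).le
    rw [this, one_mul]

end window


section kernel
variable {V : Type*} [NormedAddCommGroup V] [InnerProductSpace ℝ V] [FiniteDimensional ℝ V]
  [MeasurableSpace V] [BorelSpace V]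

theorem fourierInv_mul_bound (Θ u : SchwartzMap V ℂ) (a x : V) :
    ‖𝓕⁻ (fun ξ => Θ (ξ - a) * 𝓕 (⇑u) ξ) x‖ₑ ≤ ∫⁻ y, ‖𝓕 (⇑Θ) (y - x)‖ₑ * ‖u y‖ₑ := by
  have hΘ : Integrable (fun ξ => Θ (ξ - a)) := Θ.integrable.comp_sub_right a
  set g : V → ℂ := fun ξ => Real.fourierChar (inner ℝ ξ x) • Θ (ξ - a) with hg
  have hgi : Integrable g := by
    have := (Real.fourierIntegral_convergent_iff (μ := volume) (f := fun ξ => Θ (ξ - a)) (-x)).2 hΘ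
    simpa [hg, inner_neg_right] using this
  have h1 := VectorFourier.integral_fourierIntegral_smul_eq_flip (L := innerₗ V) (μ := volume)
    (ν := volume) (f := ⇑u) (g := g) Real.continuous_fourierChar
    (by exact continuous_inner) u.integrable hgi
  rw [flip_innerₗ] at h1
  have h2 : 𝓕⁻ (fun ξ => Θ (ξ - a) * 𝓕 (⇑u) ξ) x =
      ∫ ξ, (VectorFourier.fourierIntegral Real.fourierChar volume (innerₗ V) u ξ) • g ξ := by
    rw [Real.fourierInv_eq]
    refine integral_congr_ae (Filter.Eventually.of_forall fun ξ => ?_)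
    simp only [hg, smul_eq_mul, Circle.smul_def]
    change _ * (Θ (ξ - a) * 𝓕 (⇑u) ξ) = 𝓕 (⇑u) ξ * _
    ring
  rw [h2, h1]
  refine (enorm_integral_le_lintegral_enorm _).trans (lintegral_mono fun y => ?_)
  rw [enorm_smul, mul_comm]
  refine mul_le_mul' (le_of_eq ?_) le_rfl
  change ‖𝓕 g y‖ₑ = _
  rw [Real.fourier_eq, Real.fourier_eq]
  rw [← integral_add_right_eq_self _ a]
  have : ∀ ξ : V, Real.fourierChar (-inner ℝ (ξ + a) y) • g (ξ + a) =
      Real.fourierChar (inner ℝ a (x - y)) • (Real.fourierChar (-inner ℝ ξ (y - x)) • Θ ξ) := by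
    intro ξ
    simp only [hg, smul_smul, ← AddChar.map_add_eq_mul, add_sub_cancel_right]
    congr 2
    simp only [inner_add_left, inner_sub_right]
    ring
  simp_rw [this]
  simp only [Circle.smul_def (Real.fourierChar (inner ℝ a (x - y)))]
  have hn : ‖((Real.fourierChar (inner ℝ a (x - y)) : Circle) : ℂ)‖ₑ = 1 := by
    rw [← ofReal_norm, Circle.norm_coe, ENNReal.ofReal_one]
  rw [integral_smul, enorm_smul, hn, one_mul]

theorem schwartz_kernel_bound {V : Type*} [NormedAddCommGroup V] [InnerProductSpace ℝ V] (K : SchwartzMap V ℂ) (N : ℕ) : ∃ C : ℝ≥0∞, C ≠ ∞ ∧ ∀ z,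
    ‖K z‖ₑ ≤ C * ENNReal.ofReal ((1 + ‖z‖) ^ (-(N:ℝ))) := by
  refine ⟨ENNReal.ofReal (2 ^ N * ((Finset.Iic (N, 0)).sup
    (fun m => SchwartzMap.seminorm ℝ m.1 m.2) K)), ENNReal.ofReal_ne_top, fun z => ?_⟩
  have h := SchwartzMap.one_add_le_sup_seminorm_apply (𝕜 := ℝ) (m := (N, 0)) (k := N) (n := 0)
    le_rfl le_rfl K z
  rw [norm_iteratedFDeriv_zero] at h
  rw [← ofReal_norm, ← ENNReal.ofReal_mul (by positivity)]
  apply ENNReal.ofReal_le_ofReal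
  rw [Real.rpow_neg (by positivity), Real.rpow_natCast, ← div_eq_mul_inv, le_div_iff₀ (by positivity)]
  linarith
end kernel

section box
variable {η : ℝ → ℝ} {d : ℕ}

theorem window_mul_schwartz (φ : EuclideanSpace ℝ (Fin d) → ℂ) (hφ : ContDiff ℝ (⊤ : ℕ∞) φ)
    (hc : HasCompactSupport φ) (v : EuclideanSpace ℝ (Fin d) → ℂ) (hv : ContDiff ℝ (⊤ : ℕ∞) v) :
    ∃ g : SchwartzMap (EuclideanSpace ℝ (Fin d)) ℂ, ⇑g = fun ξ => φ ξ * v ξ :=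
  ⟨HasCompactSupport.toSchwartzMap (hc.mul_right (f' := v)) (hφ.mul hv), rfl⟩

theorem unifWindow_hasCompactSupport (hη : IsBump η) (k : Fin d → ℤ) :
    HasCompactSupport fun ξ => (unifWindow η k ξ : ℂ) := by
  refine compact_of_coord _ (1 + ∑ i, |(k i : ℝ)|) fun ξ i h => ?_
  rw [unifWindow_eq_zero hη k ξ i, Complex.ofReal_zero]
  have h1 : |(k i : ℝ)| ≤ ∑ i, |(k i : ℝ)| :=
    Finset.single_le_sum (f := fun i => |(k i : ℝ)|) (fun i _ => abs_nonneg _) (Finset.mem_univ i)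
  have h2 := abs_sub_abs_le_abs_sub (ξ i) (k i)
  linarith

theorem ofReal_contDiff {E : Type*} [NormedAddCommGroup E] [NormedSpace ℝ E] {g : E → ℝ}
    (hg : ContDiff ℝ (⊤ : ℕ∞) g) : ContDiff ℝ (⊤ : ℕ∞) fun x => (g x : ℂ) :=
  Complex.ofRealCLM.contDiff.comp hg

theorem unifBox_schwartz (hη : IsBump η) (k : Fin d → ℤ)
    (f : SchwartzMap (EuclideanSpace ℝ (Fin d)) ℂ) :
    ∃ u : SchwartzMap (EuclideanSpace ℝ (Fin d)) ℂ, ⇑u = unifBox η k f ∧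
      𝓕 (⇑u) = fun ξ => (unifWindow η k ξ : ℂ) * 𝓕 (⇑f) ξ := by
  obtain ⟨g, hg⟩ := window_mul_schwartz _ (ofReal_contDiff (unifWindow_contDiff hη k))
    (unifWindow_hasCompactSupport hη k) (⇑(𝓕 f : SchwartzMap (EuclideanSpace ℝ (Fin d)) ℂ)) (SchwartzMap.smooth _ _)
  refine ⟨𝓕⁻ g, ?_, ?_⟩
  · rw [SchwartzMap.fourierInv_coe, hg]
    rfl
  · rw [← SchwartzMap.fourier_coe, fourier_fourierInv_eq, hg]
    rfl
end box

section trace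
variable {η : ℝ → ℝ} {m : ℕ}

def embL (m : ℕ) : EuclideanSpace ℝ (Fin m) →ₗᵢ[ℝ] EuclideanSpace ℝ (Fin (m+1)) where
  toFun x := WithLp.toLp 2 (Fin.snoc (α := fun _ => ℝ) (fun i => x i) 0)
  map_add' x y := by
    ext i
    refine Fin.lastCases ?_ (fun i => ?_) i <;> simp
  map_smul' c x := by
    ext i
    refine Fin.lastCases ?_ (fun i => ?_) i <;> simp
  norm_map' x := by
    simp [EuclideanSpace.norm_eq, Fin.sum_univ_castSucc]

def prL (m : ℕ) : EuclideanSpace ℝ (Fin (m+1)) →ₗ[ℝ] EuclideanSpace ℝ (Fin m) where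
  toFun x := WithLp.toLp 2 (fun i => x (Fin.castSucc i))
  map_add' x y := by ext i; simp
  map_smul' c x := by ext i; simp

theorem inner_prL (ξ : EuclideanSpace ℝ (Fin (m+1))) (y : EuclideanSpace ℝ (Fin m)) :
    inner ℝ (prL m ξ) y = inner ℝ ξ (embL m y) := by
  simp [prL, embL, PiLp.inner_apply, Fin.sum_univ_castSucc]

theorem norm_prL_le (ξ : EuclideanSpace ℝ (Fin (m+1))) : ‖prL m ξ‖ ≤ ‖ξ‖ := by
  rw [EuclideanSpace.norm_eq, EuclideanSpace.norm_eq, Fin.sum_univ_castSucc]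
  refine Real.sqrt_le_sqrt ?_
  simp only [prL, LinearMap.coe_mk, AddHom.coe_mk]
  have := sq_nonneg ‖ξ (Fin.last m)‖
  linarith

theorem prL_embL (y : EuclideanSpace ℝ (Fin m)) : prL m (embL m y) = y := by
  ext i
  simp [prL, embL]

theorem prL_contDiff : ContDiff ℝ (⊤ : ℕ∞) (prL m) :=
  (LinearMap.toContinuousLinearMap (prL m)).contDiff

theorem traceFn_schwartz (f : SchwartzMap (EuclideanSpace ℝ (Fin (m+1))) ℂ) :
    ∃ g : SchwartzMap (EuclideanSpace ℝ (Fin m)) ℂ, ⇑g = traceFn f := by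
  refine ⟨SchwartzMap.compCLMOfAntilipschitz ℝ
    (g := embL m) (embL m).toContinuousLinearMap.hasTemperateGrowth (embL m).antilipschitz f, ?_⟩
  ext x
  rfl

theorem unifBox_trace (hη : IsBump η) (k : Fin m → ℤ)
    (f : SchwartzMap (EuclideanSpace ℝ (Fin (m+1))) ℂ) (x : EuclideanSpace ℝ (Fin m)) :
    unifBox η k (traceFn f) x =
      𝓕⁻ (fun ξ => (unifWindow η k (prL m ξ) : ℂ) * 𝓕 (⇑f) ξ) (embL m x) := by
  obtain ⟨tf, htf⟩ := traceFn_schwartz f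
  obtain ⟨g, hg⟩ := window_mul_schwartz _ (ofReal_contDiff (unifWindow_contDiff hη k))
    (unifWindow_hasCompactSupport hη k) (fun ζ => ((Real.fourierChar (inner ℝ ζ x) : Circle) : ℂ))
    (by
      simp only [Real.fourierChar_apply]
      refine ContDiff.cexp ?_
      refine ContDiff.mul (ofReal_contDiff ?_) contDiff_const
      exact contDiff_const.mul (contDiff_id.inner ℝ contDiff_const))
  set Ff : SchwartzMap (EuclideanSpace ℝ (Fin (m+1))) ℂ := 𝓕 f with hFf
  set Fg : SchwartzMap (EuclideanSpace ℝ (Fin m)) ℂ := 𝓕 g with hFg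
  have s1 : unifBox η k (traceFn f) x = ∫ ζ, 𝓕 tf ζ * g ζ := by
    unfold unifBox
    rw [Real.fourierInv_eq, ← htf, hg]
    refine integral_congr_ae (Filter.Eventually.of_forall fun ξ => ?_)
    simp only [Circle.smul_def, smul_eq_mul, SchwartzMap.fourier_coe]
    ring
  rw [s1, SchwartzMap.integral_fourier_mul_eq]
  set L : EuclideanSpace ℝ (Fin (m+1)) →ₗ[ℝ] EuclideanSpace ℝ (Fin m) →ₗ[ℝ] ℝ :=
    - ((innerₗ _).comp (prL m)) with hL
  have hLa : ∀ ξ y, L ξ y = - inner ℝ (prL m ξ) y := fun ξ y => rfl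
  have h1 := VectorFourier.integral_fourierIntegral_smul_eq_flip (L := L) (μ := volume)
    (ν := volume) (f := ⇑Ff) (g := ⇑Fg) Real.continuous_fourierChar
    (by
      simp only [hLa]
      have := (prL_contDiff (m := m)).continuous
      fun_prop) Ff.integrable Fg.integrable
  have e1 : ∀ y, VectorFourier.fourierIntegral Real.fourierChar volume L (⇑Ff) y = tf y := by
    intro y
    have : f (embL m y) = 𝓕⁻ (⇑Ff) (embL m y) := by
      rw [← SchwartzMap.fourierInv_coe, hFf, fourierInv_fourier_eq]
    rw [htf]
    change _ = f (embL m y)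
    rw [this, Real.fourierInv_eq]
    simp [VectorFourier.fourierIntegral, hLa, inner_prL]
  have e2 : ∀ ξ, VectorFourier.fourierIntegral Real.fourierChar volume L.flip (⇑Fg) ξ =
      g (prL m ξ) := by
    intro ξ
    have : g (prL m ξ) = 𝓕⁻ (⇑Fg) (prL m ξ) := by
      rw [← SchwartzMap.fourierInv_coe, hFg, fourierInv_fourier_eq]
    rw [this, Real.fourierInv_eq]
    simp [VectorFourier.fourierIntegral, hLa, real_inner_comm]
  simp only [e1, e2, smul_eq_mul] at h1
  rw [← hFg, h1, Real.fourierInv_eq]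
  refine integral_congr_ae (Filter.Eventually.of_forall fun ξ => ?_)
  simp only [hg, hFf, Circle.smul_def, smul_eq_mul, SchwartzMap.fourier_coe, inner_prL]
  ring

end trace


section final
variable {η : ℝ → ℝ} {m : ℕ}

/-- The piece of `□_k Tr f` coming from the frequency cube `l`, before restriction. -/
def piece (η : ℝ → ℝ) (k : Fin m → ℤ) (l : Fin (m+1) → ℤ)
    (f : EuclideanSpace ℝ (Fin (m+1)) → ℂ) : EuclideanSpace ℝ (Fin (m+1)) → ℂ :=
  𝓕⁻ (fun ξ => ((unifWindow η k (prL m ξ) : ℂ) * (unifWindow η l ξ : ℂ)) * 𝓕 f ξ)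

theorem piece_schwartz (hη : IsBump η) (k : Fin m → ℤ) (l : Fin (m+1) → ℤ)
    (f : SchwartzMap (EuclideanSpace ℝ (Fin (m+1))) ℂ) :
    ∃ g : SchwartzMap (EuclideanSpace ℝ (Fin (m+1))) ℂ, ⇑g = piece η k l f ∧
      (⇑(𝓕 g : SchwartzMap (EuclideanSpace ℝ (Fin (m+1))) ℂ)) = fun ξ =>
        ((unifWindow η k (prL m ξ) : ℂ) * (unifWindow η l ξ : ℂ)) * 𝓕 (⇑f) ξ := by
  obtain ⟨g, hg⟩ := window_mul_schwartz
    (fun ξ => ((unifWindow η k (prL m ξ) : ℂ) * (unifWindow η l ξ : ℂ)))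
    ((ofReal_contDiff ((unifWindow_contDiff hη k).comp prL_contDiff)).mul
      (ofReal_contDiff (unifWindow_contDiff hη l)))
    ((unifWindow_hasCompactSupport hη l).mul_left)
    (⇑(𝓕 f : SchwartzMap (EuclideanSpace ℝ (Fin (m+1))) ℂ)) (SchwartzMap.smooth _ _)
  refine ⟨𝓕⁻ g, ?_, ?_⟩
  · rw [SchwartzMap.fourierInv_coe, hg]
    rfl
  · rw [fourier_fourierInv_eq, hg]
    rfl

theorem enorm_unifBox_trace_le (hη : IsBump η) (k : Fin m → ℤ)
    (f : SchwartzMap (EuclideanSpace ℝ (Fin (m+1))) ℂ) (x : EuclideanSpace ℝ (Fin m)) :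
    ‖unifBox η k (traceFn f) x‖ₑ ≤ ∑' l, ‖piece η k l f (embL m x)‖ₑ := by
  set Ff : SchwartzMap (EuclideanSpace ℝ (Fin (m+1))) ℂ := 𝓕 f with hFf
  have hFc : 𝓕 (⇑f) = ⇑Ff := rfl
  rw [unifBox_trace hη]
  unfold piece
  simp only [Real.fourierInv_eq, hFc]
  set F : (Fin (m+1) → ℤ) → EuclideanSpace ℝ (Fin (m+1)) → ℂ := fun l ξ =>
    Real.fourierChar (inner ℝ ξ (embL m x)) •
      (((unifWindow η k (prL m ξ) : ℂ) * (unifWindow η l ξ : ℂ)) * Ff ξ) with hF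
  have hmeas : ∀ l, AEStronglyMeasurable (F l) volume := by
    intro l
    apply Continuous.aestronglyMeasurable
    have h1 := ((unifWindow_contDiff hη k).comp (prL_contDiff (m := m))).continuous
    have h2 := (unifWindow_contDiff hη l).continuous
    have h3 := Ff.continuous
    have h4 := Real.continuous_fourierChar
    simp only [hF, Circle.smul_def, smul_eq_mul]
    have h1' : Continuous fun ξ => unifWindow η k (prL m ξ) := h1
    fun_prop
  have hpt : ∀ ξ, HasSum (fun l => F l ξ) (Real.fourierChar (inner ℝ ξ (embL m x)) •
      ((unifWindow η k (prL m ξ) : ℂ) * Ff ξ)) := by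
    intro ξ
    have h := Complex.hasSum_ofReal.2 (unifWindow_hasSum hη ξ)
    have h' := (h.mul_left ((Real.fourierChar (inner ℝ ξ (embL m x)) : ℂ) *
      (unifWindow η k (prL m ξ) : ℂ))).mul_right (Ff ξ)
    convert! h' using 1
    · ext l
      simp only [hF, Circle.smul_def, smul_eq_mul]; ring
    · simp only [Circle.smul_def, smul_eq_mul, Complex.ofReal_one]; ring
  have hfin : ∑' l, ∫⁻ ξ, ‖F l ξ‖ₑ ≠ ∞ := by
    rw [← lintegral_tsum fun l => (hmeas l).enorm]
    refine ne_top_of_le_ne_top Ff.integrable.2.ne (lintegral_mono fun ξ => ?_)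
    have hb : ∀ l, ‖F l ξ‖ₑ ≤ ENNReal.ofReal (unifWindow η l ξ) * ‖Ff ξ‖ₑ := by
      intro l
      rw [← ofReal_norm, ← ofReal_norm, ← ENNReal.ofReal_mul (unifWindow_nonneg hη l ξ)]
      apply ENNReal.ofReal_le_ofReal
      simp only [hF, Circle.norm_smul, norm_mul, Complex.norm_real, Real.norm_eq_abs,
        abs_of_nonneg (unifWindow_nonneg hη _ _)]
      have h1 := unifWindow_le_one hη k (prL m ξ)
      have h2 := unifWindow_nonneg hη l ξ
      gcongr
      nlinarith
    refine (ENNReal.tsum_le_tsum hb).trans ?_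
    rw [ENNReal.tsum_mul_right, ← ENNReal.ofReal_tsum_of_nonneg
      (fun l => unifWindow_nonneg hη l ξ) (unifWindow_hasSum hη ξ).summable,
      (unifWindow_hasSum hη ξ).tsum_eq]
    simp
  have := integral_tsum hmeas hfin
  simp only [(hpt _).tsum_eq] at this
  rw [this]
  exact enorm_tsum_le_tsum_enorm

theorem piece_eq_zero (hη : IsBump η) (k : Fin m → ℤ) (l : Fin (m+1) → ℤ)
    (f : EuclideanSpace ℝ (Fin (m+1)) → ℂ) (i : Fin m) (h : 2 ≤ |l i.castSucc - k i|) :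
    piece η k l f = 0 := by
  ext x
  unfold piece
  have : ∀ ξ, ((unifWindow η k (prL m ξ) : ℂ) * (unifWindow η l ξ : ℂ)) * 𝓕 f ξ = 0 := by
    intro ξ
    have h' : (2:ℝ) ≤ |(l i.castSucc : ℝ) - k i| := by exact_mod_cast h
    by_cases h1 : 1 ≤ |ξ i.castSucc - l i.castSucc|
    · rw [unifWindow_eq_zero hη l ξ _ h1]; simp
    · have : 1 ≤ |prL m ξ i - k i| := by
        have e : prL m ξ i = ξ i.castSucc := rfl
        rw [e]
        have := abs_sub_le (l i.castSucc : ℝ) (ξ i.castSucc) (k i)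
        rw [abs_sub_comm (l i.castSucc : ℝ) (ξ i.castSucc)] at this
        linarith
      rw [unifWindow_eq_zero hη k _ i this]; simp
  simp [this, Real.fourierInv_eq]

/-- The multiplier producing a piece out of a box, moved to the origin. -/
theorem theta_exists (hη : IsBump η) (j : Fin m → ℤ) :
    ∃ Θ : SchwartzMap (EuclideanSpace ℝ (Fin (m+1))) ℂ, ⇑Θ = fun ξ =>
      (bigWindow η ξ : ℂ) * (unifWindow η (-j) (prL m ξ) : ℂ) :=
  window_mul_schwartz _ (ofReal_contDiff (bigWindow_contDiff hη))
    (compact_of_coord _ 2 fun ξ i h => by rw [bigWindow_eq_zero hη ξ i h, Complex.ofReal_zero]) _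
    (ofReal_contDiff ((unifWindow_contDiff hη (-j)).comp prL_contDiff))

theorem big_exists (hη : IsBump η) :
    ∃ Θ : SchwartzMap (EuclideanSpace ℝ (Fin (m+1))) ℂ, ⇑Θ = fun ξ => (bigWindow η ξ : ℂ) := by
  obtain ⟨Θ, h⟩ := window_mul_schwartz (fun ξ : EuclideanSpace ℝ (Fin (m+1)) => (bigWindow η ξ : ℂ))
    (ofReal_contDiff (bigWindow_contDiff hη))
    (compact_of_coord _ 2 fun ξ i h => by rw [bigWindow_eq_zero hη ξ i h, Complex.ofReal_zero])
    (fun _ => 1) contDiff_const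
  exact ⟨Θ, by simpa using h⟩

/-- Polynomially decaying weight. -/
def pw {V : Type*} [NormedAddCommGroup V] (N : ℕ) (z : V) : ℝ≥0∞ :=
  ENNReal.ofReal ((1 + ‖z‖) ^ (-(N:ℝ)))

theorem kernel_bounds (hη : IsBump η) (N : ℕ) : ∃ C0 : ℝ≥0∞, C0 ≠ ∞ ∧
    ∀ f : SchwartzMap (EuclideanSpace ℝ (Fin (m+1))) ℂ,
    (∀ l y, ‖unifBox η l f y‖ₑ ≤ C0 * ∫⁻ z, pw N (z - y) * ‖unifBox η l f z‖ₑ) ∧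
    (∀ (k j : Fin m → ℤ) (t : ℤ) x, j ∈ Finset.Icc (-1 : Fin m → ℤ) 1 →
      ‖piece η k (Fin.snoc (α := fun _ => ℤ) (k + j) t) f x‖ₑ ≤
        C0 * ∫⁻ z, pw N (z - x) * ‖unifBox η (Fin.snoc (α := fun _ => ℤ) (k + j) t) f z‖ₑ) := by
  obtain ⟨B, hB⟩ := big_exists (m := m) hη
  choose Θ hΘ using theta_exists (m := m) hη
  obtain ⟨Cb, hCb, hCb'⟩ := schwartz_kernel_bound (𝓕 B) N
  choose C hC hC' using fun j => schwartz_kernel_bound (𝓕 (Θ j)) N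
  have gen : ∀ (T u : SchwartzMap (EuclideanSpace ℝ (Fin (m+1))) ℂ) (c C0 : ℝ≥0∞), c ≤ C0 →
      C0 ≠ ∞ →
      (∀ z, ‖(𝓕 T : SchwartzMap (EuclideanSpace ℝ (Fin (m+1))) ℂ) z‖ₑ ≤ c *
        ENNReal.ofReal ((1 + ‖z‖) ^ (-(N:ℝ)))) → ∀ a x,
      ‖𝓕⁻ (fun ξ => T (ξ - a) * 𝓕 (⇑u) ξ) x‖ₑ ≤ C0 * ∫⁻ z, pw N (z - x) * ‖u z‖ₑ := by
    intro T u c C0 hc hC0 hT a x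
    refine (fourierInv_mul_bound T u a x).trans ?_
    rw [← lintegral_const_mul' _ _ hC0]
    refine lintegral_mono fun z => ?_
    rw [← mul_assoc]
    refine mul_le_mul' ?_ le_rfl
    exact (hT (z - x)).trans (mul_le_mul' hc le_rfl)
  have hC0 : Cb + ∑ j ∈ Finset.Icc (-1 : Fin m → ℤ) 1, C j ≠ ∞ :=
    ENNReal.add_ne_top.2 ⟨hCb, ENNReal.sum_ne_top.2 fun j _ => hC j⟩
  refine ⟨_, hC0, fun f => ⟨fun l y => ?_, fun k j t x hj => ?_⟩⟩
  · obtain ⟨u, hu, hFu⟩ := unifBox_schwartz hη l f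
    rw [← hu]
    have h := gen B u Cb _ le_self_add hC0 hCb' (intVec l) y
    have e : (fun ξ => B (ξ - intVec l) * 𝓕 (⇑u) ξ) = fun ξ => (unifWindow η l ξ : ℂ) * 𝓕 (⇑f) ξ := by
      ext ξ
      rw [hFu, hB]
      simp only
      rw [← mul_assoc, ← Complex.ofReal_mul, bigWindow_mul hη]
    rw [e] at h
    rw [hu] at h ⊢
    exact h
  · set l : Fin (m+1) → ℤ := Fin.snoc (α := fun _ => ℤ) (k + j) t with hl
    obtain ⟨u, hu, hFu⟩ := unifBox_schwartz hη l f
    rw [← hu]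
    have h := gen (Θ j) u (C j) _ ((Finset.single_le_sum (f := C) (fun _ _ => zero_le) hj).trans
      le_add_self) hC0 (hC' j) (intVec l) x
    have e : (fun ξ => Θ j (ξ - intVec l) * 𝓕 (⇑u) ξ) = fun ξ =>
        ((unifWindow η k (prL m ξ) : ℂ) * (unifWindow η l ξ : ℂ)) * 𝓕 (⇑f) ξ := by
      ext ξ
      rw [hFu, hΘ]
      simp only
      have e1 : unifWindow η (-j) (prL m (ξ - intVec l)) = unifWindow η k (prL m ξ) := by
        have e2 := unifWindow_translate (η := η) (k + j) (-j) (prL m (ξ - intVec l))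
        rw [add_neg_cancel_right] at e2
        rw [← e2]
        congr 1
        ext i
        simp [prL, intVec, hl]
      rw [e1]
      have := congrArg (fun x : ℝ => (x : ℂ)) (bigWindow_mul hη l ξ)
      push_cast at this
      linear_combination ((unifWindow η k (prL m ξ) : ℂ) * 𝓕 (⇑f) ξ) * this
    rw [e] at h
    exact h

theorem pw_le_one {V : Type*} [NormedAddCommGroup V] (N : ℕ) (z : V) : pw N z ≤ 1 := by
  unfold pw
  rw [ENNReal.ofReal_le_one]
  exact Real.rpow_le_one_of_one_le_of_nonpos (by linarith [norm_nonneg z])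
    (by simp)

theorem pw_sub {V : Type*} [NormedAddCommGroup V] (N : ℕ) (x y z : V) :
    pw N (y - x) * pw N (z - y) ≤ pw N (z - x) := by
  unfold pw
  rw [← ENNReal.ofReal_mul (by positivity), ← Real.mul_rpow (by positivity) (by positivity)]
  apply ENNReal.ofReal_le_ofReal
  refine Real.rpow_le_rpow_of_nonpos (by positivity) ?_ (by simp)
  have := norm_add_le (y - x) (z - y)
  rw [show y - x + (z - y) = z - x by abel] at this
  nlinarith [norm_nonneg (y - x), norm_nonneg (z - y)]

theorem trace_pieces (hη : IsBump η) (p : ℝ≥0∞) (hp : 0 < p) : ∃ D : ℝ≥0∞, D ≠ ∞ ∧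
    ∀ (f : SchwartzMap (EuclideanSpace ℝ (Fin (m+1))) ℂ) (k j : Fin m → ℤ) (t : ℤ),
      j ∈ Finset.Icc (-1 : Fin m → ℤ) 1 →
      eLpNorm (fun x => ‖piece η k (Fin.snoc (α := fun _ => ℤ) (k + j) t) f (embL m x)‖ₑ) p volume ≤
        D * eLpNorm (unifBox η (Fin.snoc (α := fun _ => ℤ) (k + j) t) f) p volume := by
  have hmin : 0 < (min p 1).toReal :=
    ENNReal.toReal_pos (lt_min hp one_pos).ne' (ne_top_of_le_ne_top ENNReal.one_ne_top (min_le_right _ _))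
  obtain ⟨N, hN⟩ := exists_nat_gt (max ((m:ℝ) + 1) (m / (min p 1).toReal))
  have hN1 : ((m:ℝ) + 1) < N := (le_max_left _ _).trans_lt hN
  have hN2 : (m:ℝ) < N * (min p 1).toReal := by
    rw [← div_lt_iff₀ hmin]
    exact (le_max_right _ _).trans_lt hN
  obtain ⟨C0, hC0, hker⟩ := kernel_bounds (m := m) hη N
  have hpwm : Measurable (pw (V := EuclideanSpace ℝ (Fin (m+1))) N) := by
    unfold pw; fun_prop
  obtain ⟨D, hD, h⟩ := trace_Lp_bound (volume : Measure (EuclideanSpace ℝ (Fin (m+1))))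
    (volume : Measure (EuclideanSpace ℝ (Fin m))) (embL m) (embL m).continuous.measurable
    (pw N) hpwm (pw_le_one N) (pw_sub N) p hp
    (∫⁻ z : EuclideanSpace ℝ (Fin (m+1)), ENNReal.ofReal ((1 + ‖z‖) ^ (-(N:ℝ))))
    (∫⁻ z : EuclideanSpace ℝ (Fin m), ENNReal.ofReal ((1 + ‖z‖) ^ (-(N * (min p 1).toReal))))
    (finite_integral_one_add_norm (by simpa using hN1)).ne
    (finite_integral_one_add_norm (by simpa using hN2)).ne
    (fun x => (lintegral_sub_right_eq_self (pw N) x).le)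
    (fun z => by
      refine le_trans (lintegral_mono fun x => ?_) (lintegral_sub_left_eq_self (fun y :
        EuclideanSpace ℝ (Fin m) => ENNReal.ofReal ((1 + ‖y‖) ^ (-(N * (min p 1).toReal))))
        (prL m z)).le
      unfold pw
      rw [ENNReal.ofReal_rpow_of_nonneg (by positivity) hmin.le, ← Real.rpow_mul (by positivity)]
      apply ENNReal.ofReal_le_ofReal
      rw [neg_mul]
      refine Real.rpow_le_rpow_of_nonpos (by positivity) ?_ (by simp; positivity)
      have := norm_prL_le (z - embL m x)
      rw [map_sub, prL_embL] at this
      linarith) C0 hC0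
  refine ⟨D, hD, fun f k j t hj => ?_⟩
  obtain ⟨hk1, hk2⟩ := hker f
  set l : Fin (m+1) → ℤ := Fin.snoc (α := fun _ => ℤ) (k + j) t with hl
  obtain ⟨u, hu, -⟩ := unifBox_schwartz hη l f
  have hb : ∃ M : ℝ≥0∞, M ≠ ∞ ∧ ∀ y, ‖unifBox η l f y‖ₑ ≤ M := by
    obtain ⟨c, hc, hc'⟩ := schwartz_kernel_bound u 0
    refine ⟨c, hc, fun y => ?_⟩
    rw [← hu]
    simpa using hc' y
  obtain ⟨M, hM, hMb⟩ := hb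
  have := h (fun y => ‖unifBox η l f y‖ₑ)
    (fun x => ‖piece η k l f (embL m x)‖ₑ) M hM (by rw [← hu]; exact u.continuous.enorm.measurable)
    hMb (hk1 l) (fun x => hk2 k j t _ hj)
  refine this.trans (le_of_eq ?_)
  congr 1

end final


section assembling
variable {η : ℝ → ℝ} {m : ℕ}

theorem jbr_weight (s a : ℝ) (hs : 0 ≤ s) (ha : 0 ≤ a) (k j : Fin m → ℤ)
    (hj : j ∈ Finset.Icc (-1 : Fin m → ℤ) 1) (t : ℤ) :
    jbr k ^ s ≤ (2 + 2 * (m:ℝ)) ^ (s / 2) * ((1 + (t:ℝ)^2) ^ (-a / 2) *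
      jbr (Fin.snoc (α := fun _ => ℤ) (k + j) t) ^ (s + a)) := by
  rw [Finset.mem_Icc] at hj
  set X : ℝ := 1 + ∑ i, (((k + j) i : ℤ) : ℝ) ^ 2 with hX
  have hX1 : 1 ≤ X := by
    have : 0 ≤ ∑ i, (((k + j) i : ℤ) : ℝ) ^ 2 := Finset.sum_nonneg fun i _ => sq_nonneg _
    linarith
  have hK0 : 0 ≤ 1 + ∑ i, ((k i : ℤ) : ℝ) ^ 2 := by positivity
  have hk : 1 + ∑ i, ((k i : ℤ) : ℝ) ^ 2 ≤ (2 + 2 * (m:ℝ)) * X := by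
    have h1 : ∑ i, ((k i : ℤ) : ℝ) ^ 2 ≤ ∑ i : Fin m, (2 * (((k + j) i : ℤ) : ℝ) ^ 2 + 2) := by
      refine Finset.sum_le_sum fun i _ => ?_
      have h2 : (-1:ℝ) ≤ j i := by exact_mod_cast hj.1 i
      have h3 : (j i : ℝ) ≤ 1 := by exact_mod_cast hj.2 i
      simp only [Pi.add_apply, Int.cast_add]
      nlinarith [sq_nonneg ((k i : ℝ) + 2 * j i)]
    rw [Finset.sum_add_distrib, ← Finset.mul_sum] at h1
    simp only [Finset.sum_const, Finset.card_univ, Fintype.card_fin, nsmul_eq_mul] at h1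
    have hm0 : (0:ℝ) ≤ m := by positivity
    nlinarith
  have hl : jbr (Fin.snoc (α := fun _ => ℤ) (k + j) t) = (X + (t:ℝ)^2) ^ ((1:ℝ)/2) := by
    unfold jbr
    rw [Fin.sum_univ_castSucc]
    simp only [Fin.snoc_castSucc, Fin.snoc_last]
    rw [hX]; congr 1; ring
  have hXt : 0 < X + (t:ℝ)^2 := by positivity
  have hT : 0 < 1 + (t:ℝ)^2 := by positivity
  rw [hl, jbr, ← Real.rpow_mul hK0, ← Real.rpow_mul hXt.le]
  have e1 : (1:ℝ) / 2 * (s + a) = s / 2 + a / 2 := by ring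
  have e2 : (1:ℝ) / 2 * s = s / 2 := by ring
  rw [e1, e2, Real.rpow_add hXt]
  have h1 : (1:ℝ) ≤ (1 + (t:ℝ)^2) ^ (-a / 2) * (X + (t:ℝ)^2) ^ (a / 2) := by
    rw [neg_div, Real.rpow_neg hT.le, inv_mul_eq_div, one_le_div (by positivity)]
    exact Real.rpow_le_rpow hT.le (by linarith) (by positivity)
  calc _ ≤ ((2 + 2 * (m:ℝ)) * X) ^ (s / 2) := Real.rpow_le_rpow hK0 hk (by positivity)
    _ = (2 + 2 * (m:ℝ)) ^ (s / 2) * X ^ (s / 2) := Real.mul_rpow (by positivity) (by positivity)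
    _ ≤ (2 + 2 * (m:ℝ)) ^ (s / 2) * (X + (t:ℝ)^2) ^ (s / 2) := by
        gcongr
        nlinarith [sq_nonneg (t:ℝ)]
    _ ≤ (2 + 2 * (m:ℝ)) ^ (s / 2) * (X + (t:ℝ)^2) ^ (s / 2) *
        ((1 + (t:ℝ)^2) ^ (-a / 2) * (X + (t:ℝ)^2) ^ (a / 2)) :=
        le_mul_of_one_le_right (by positivity) h1
    _ = _ := by ring

/-- Bound of a single frequency box of the trace by the neighbouring boxes. -/
theorem box_trace_bound (hη : IsBump η) (p : ℝ≥0∞) (hp : 0 < p) (r : ℝ) (hr : 0 < r)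
    (hr1 : r ≤ 1) (hrp : ENNReal.ofReal r ≤ p) : ∃ D : ℝ≥0∞, D ≠ ∞ ∧
    ∀ (f : SchwartzMap (EuclideanSpace ℝ (Fin (m+1))) ℂ) (k : Fin m → ℤ),
      eLpNorm (unifBox η k (traceFn f)) p volume ^ r ≤
        D * ∑ j ∈ Finset.Icc (-1 : Fin m → ℤ) 1, ∑' t : ℤ,
          eLpNorm (unifBox η (Fin.snoc (α := fun _ => ℤ) (k + j) t) f) p volume ^ r := by
  obtain ⟨D, hD, h⟩ := trace_pieces (m := m) hη p hp
  refine ⟨D ^ r, ENNReal.rpow_ne_top_of_nonneg hr.le hD, fun f k => ?_⟩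
  set H : (Fin (m+1) → ℤ) → EuclideanSpace ℝ (Fin m) → ℝ≥0∞ :=
    fun l x => ‖piece η k l f (embL m x)‖ₑ with hH
  have hmeas : ∀ l, Measurable (H l) := by
    intro l
    obtain ⟨g, hg, -⟩ := piece_schwartz hη k l f
    simp only [hH, ← hg]
    exact (g.continuous.comp (embL m).continuous).enorm.measurable
  calc eLpNorm (unifBox η k (traceFn f)) p volume ^ r
      ≤ eLpNorm (fun x => ∑' l, H l x) p volume ^ r := by
        refine ENNReal.rpow_le_rpow (eLpNorm_mono_enorm fun x => ?_) hr.le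
        rw [enorm_eq_self]
        exact enorm_unifBox_trace_le hη k f x
    _ ≤ ∑' l, eLpNorm (H l) p volume ^ r := eLpNorm_tsum_rpow_le _ H hmeas p hp r hr hr1 hrp
    _ = ∑' j : Fin m → ℤ, ∑' t : ℤ,
          eLpNorm (H (Fin.snoc (α := fun _ => ℤ) (k + j) t)) p volume ^ r := by
        refine Eq.symm (((Equiv.addLeft k).tsum_eq (fun j : Fin m → ℤ => ∑' t : ℤ,
          eLpNorm (H (Fin.snoc (α := fun _ => ℤ) j t)) p volume ^ r)).trans ?_)
        rw [ENNReal.tsum_comm, ← ENNReal.tsum_prod,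
          ← (Fin.snocEquiv fun _ : Fin (m+1) => ℤ).tsum_eq (fun l => eLpNorm (H l) p volume ^ r)]
        rfl
    _ = ∑ j ∈ Finset.Icc (-1 : Fin m → ℤ) 1, ∑' t : ℤ,
          eLpNorm (H (Fin.snoc (α := fun _ => ℤ) (k + j) t)) p volume ^ r := by
        refine tsum_eq_sum fun j hj => ?_
        have hex : ∃ i, 2 ≤ |j i| := by
          by_contra hcon
          push Not at hcon
          apply hj
          rw [Finset.mem_Icc]
          constructor
          · intro i
            have := abs_lt.1 (hcon i)
            simp only [Pi.neg_apply, Pi.one_apply]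
            omega
          · intro i
            have := abs_lt.1 (hcon i)
            simp only [Pi.one_apply]
            omega
        obtain ⟨i, hi⟩ := hex
        refine ENNReal.tsum_eq_zero.2 fun t => ?_
        have hz : H (Fin.snoc (α := fun _ => ℤ) (k + j) t) = fun _ => 0 := by
          ext x
          simp only [hH]
          rw [piece_eq_zero hη k _ f i (by simpa using hi)]
          simp
        rw [hz, eLpNorm_zero', ENNReal.zero_rpow_of_pos hr]
    _ ≤ _ := by
        rw [Finset.mul_sum]
        refine Finset.sum_le_sum fun j hj => ?_
        rw [← ENNReal.tsum_mul_left]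
        refine ENNReal.tsum_le_tsum fun t => ?_
        rw [← ENNReal.mul_rpow_of_nonneg _ _ hr.le]
        exact ENNReal.rpow_le_rpow (h f k j t hj) hr.le

end assembling

/-- For `n = m+1 ≥ 2`, `0 < p, q ≤ ∞`, `s ≥ 0` and `ε > 0`,
`‖Tr f‖_{M^s_{p,q}(ℝ^{n-1})} ≤ C ‖f‖_{M^{s + 1/min(p,q,1) - 1/q + ε}_{p,q}(ℝⁿ)}`
(with `1/q = 0` for `q = ∞`). -/
theorem trace_modulation_isotropic_bound
    (m : ℕ) (hm : 1 ≤ m) (η : ℝ → ℝ) (hη : IsBump η)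
    (p q : ℝ≥0∞) (hp : 0 < p) (hq : 0 < q) (s : ℝ) (hs : 0 ≤ s) (ε : ℝ) (hε : 0 < ε) :
    ∃ C : ℝ≥0∞, 0 < C ∧ C ≠ ∞ ∧
      ∀ f : SchwartzMap (EuclideanSpace ℝ (Fin (m+1))) ℂ,
        modNorm η s p q (traceFn (⇑f)) ≤
          C * modNorm η (s + 1 / (min p (min q 1)).toReal - (if q = ∞ then 0 else 1 / q.toReal) + ε)
            p q (⇑f) := by
  have hmt : min p (min q 1) ≠ ∞ :=
    ne_top_of_le_ne_top ENNReal.one_ne_top ((min_le_right _ _).trans (min_le_right _ _))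
  set r : ℝ := (min p (min q 1)).toReal with hrdef
  have hofr : ENNReal.ofReal r = min p (min q 1) := ENNReal.ofReal_toReal hmt
  have hr : 0 < r := ENNReal.toReal_pos (lt_min hp (lt_min hq one_pos)).ne' hmt
  have hrp : ENNReal.ofReal r ≤ p := hofr ▸ min_le_left _ _
  have hrq : ENNReal.ofReal r ≤ q := hofr ▸ (min_le_right _ _).trans (min_le_left _ _)
  have hr1 : r ≤ 1 := by
    rw [← ENNReal.ofReal_le_one, hofr]
    exact (min_le_right _ _).trans (min_le_right _ _)
  set qi : ℝ := if q = ∞ then 0 else 1 / q.toReal with hqi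
  have hqir : qi ≤ 1 / r := by
    rw [hqi]
    split_ifs with h
    · positivity
    · exact one_div_le_one_div_of_le hr ((ENNReal.ofReal_le_iff_le_toReal h).1 hrq)
  set a : ℝ := 1 / r - qi + ε with ha
  have ha0 : 0 ≤ a := by rw [ha]; linarith
  have hσ : s + 1 / r - qi + ε = s + a := by rw [ha]; ring
  rw [hσ]
  obtain ⟨D, hD, hbox⟩ := box_trace_bound (m := m) hη p hp r hr hr1 hrp
  set K : ℝ≥0∞ := ENNReal.ofReal ((2 + 2 * (m:ℝ)) ^ (s / 2)) with hK
  obtain ⟨E, hE, hseq⟩ := seq_bound m q hq r hr hrq (a * r) (by positivity) (by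
      rw [← hqi, ha]
      have : (1 / r - qi + ε) * r = 1 - r * qi + ε * r := by field_simp
      rw [this]
      nlinarith [mul_pos hε hr]) (K ^ r * D)
    (ENNReal.mul_ne_top (ENNReal.rpow_ne_top_of_nonneg hr.le ENNReal.ofReal_ne_top) hD)
    (Finset.Icc (-1) 1)
  refine ⟨E + 1, by simp, by simp [hE], fun f => ?_⟩
  refine (hseq _ (fun l => ENNReal.ofReal (jbr l ^ (s + a)) * eLpNorm (unifBox η l f) p volume)
    fun k => ?_).trans (mul_le_mul' le_self_add le_rfl)
  rw [ENNReal.mul_rpow_of_nonneg _ _ hr.le]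
  refine (mul_le_mul' le_rfl (hbox f k)).trans ?_
  rw [mul_left_comm, mul_comm (K ^ r) D, mul_assoc]
  refine mul_le_mul' le_rfl ?_
  rw [Finset.mul_sum, Finset.mul_sum]
  refine Finset.sum_le_sum fun j hj => ?_
  rw [← ENNReal.tsum_mul_left, ← ENNReal.tsum_mul_left]
  refine ENNReal.tsum_le_tsum fun t => ?_
  rw [← wt_rpow a r hr.le, ← ENNReal.mul_rpow_of_nonneg _ _ hr.le,
    ← ENNReal.mul_rpow_of_nonneg _ _ hr.le, ← ENNReal.mul_rpow_of_nonneg _ _ hr.le]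
  refine ENNReal.rpow_le_rpow ?_ hr.le
  rw [← mul_assoc, ← mul_assoc]
  refine mul_le_mul' ?_ le_rfl
  rw [hK, wt, mul_assoc, ← ENNReal.ofReal_mul (by positivity), ← ENNReal.ofReal_mul (by positivity)]
  exact ENNReal.ofReal_le_ofReal (jbr_weight s a hs ha0 k j hj t)
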